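/- arXiv:2407.04276 — 2 statements merged into one kernel-verified Lean document; each statement's English description precedes it below -/
import Mathlib

section
/- Let c₀, c₁, c₂, … ∈ Z with c_j ∈ Z* for every j ≥ 1. Then the sequence of convergents s_n/t_n = [c₀; c₁, …, c_n] converges to an element α of K, and moreover |α − s_n/t_n| = 1/(|t_n| |t_{n+1}|) for every n. -/
open scoped Classical

/-- The Ruban digit set `X₁ = { Σ_{j=0}^k a_j p^{-j} : a_j ∈ {0,…,p-1} }` inside `ℚ_p`. -/
def RubanDigitSet (p : ℕ) [Fact p.Prime] : Set ℚ_[p] :=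
  {x | ∃ (k : ℕ) (a : ℕ → ℕ), (∀ j, j ≤ k → a j < p) ∧
    x = ∑ j ∈ Finset.range (k + 1), (a j : ℚ_[p]) * ((p : ℚ_[p])⁻¹) ^ j}

/-- The Browkin digit set `X₂ = { Σ_{j=0}^k a_j p^{-j} : a_j ∈ {-(p-1)/2,…,(p-1)/2} }`. -/
def BrowkinDigitSet (p : ℕ) [Fact p.Prime] : Set ℚ_[p] :=
  {x | ∃ (k : ℕ) (a : ℕ → ℤ), (∀ j, j ≤ k → 2 * |a j| ≤ (p : ℤ) - 1) ∧
    x = ∑ j ∈ Finset.range (k + 1), (a j : ℚ_[p]) * ((p : ℚ_[p])⁻¹) ^ j}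

/-- The set `Z = { Σ_i Σ_j b_{i,j} γ^j β^i : b_{i,j} ∈ X }` of partial quotients. -/
def Zset (p : ℕ) [Fact p.Prime] (K : Type*) [Field K] [Algebra ℚ_[p] K]
    (e f : ℕ) (γ β : K) (X : Set ℚ_[p]) : Set K :=
  {z | ∃ b : Fin e → Fin f → ℚ_[p], (∀ i j, b i j ∈ X) ∧
    z = ∑ i : Fin e, ∑ j : Fin f,
      algebraMap ℚ_[p] K (b i j) * γ ^ (j : ℕ) * β ^ (i : ℕ)}

/-- `Z* = {c ∈ Z : |c| > 1}`. -/
def ZsetStar (p : ℕ) [Fact p.Prime] (K : Type*) [NormedField K] [Algebra ℚ_[p] K]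
    (e f : ℕ) (γ β : K) (X : Set ℚ_[p]) : Set K :=
  {z | z ∈ Zset p K e f γ β X ∧ 1 < ‖z‖}

/-- In a proper ultrametric normed field, norms exceeding `1` are bounded away from `1`. -/
theorem exists_one_lt_forall_le_norm_of_one_lt_norm (K : Type*) [NontriviallyNormedField K]
    [IsUltrametricDist K] [ProperSpace K] :
    ∃ R : ℝ, 1 < R ∧ ∀ x : K, 1 < ‖x‖ → R ≤ ‖x‖ := by
  have hcpt : IsCompact (Metric.ball (0 : K) 1) :=
    (isCompact_closedBall (0 : K) 1).of_isClosed_subset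
      (IsUltrametricDist.isClosed_ball 0 1) Metric.ball_subset_closedBall
  obtain ⟨y, hy, hmax⟩ := hcpt.exists_isMaxOn ⟨0, by simp⟩ continuous_norm.continuousOn
  have hinv {x : K} (hx : 1 < ‖x‖) : ‖x‖⁻¹ ≤ ‖y‖ := by
    have hmem : x⁻¹ ∈ Metric.ball (0 : K) 1 := by
      simpa using inv_lt_one_of_one_lt₀ hx
    simpa using hmax hmem
  obtain ⟨z, hz⟩ := NormedField.exists_one_lt_norm K
  have hy0 : 0 < ‖y‖ := (inv_pos.2 (one_pos.trans hz)).trans_le (hinv hz)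
  exact ⟨‖y‖⁻¹, (one_lt_inv₀ hy0).2 (by simpa using hy),
    fun x hx => inv_le_of_inv_le₀ (one_pos.trans hx) (hinv hx)⟩

/-- A sequence in a complete ultrametric group whose successive differences have strictly
decreasing norms bounded by a geometric sequence converges, and the distance from its `n`-th term
to the limit is the norm of the `n`-th difference. -/
theorem exists_tendsto_norm_sub_eq_of_strictAnti {E : Type*} [NormedAddCommGroup E]
    [IsUltrametricDist E] [CompleteSpace E] {x : ℕ → E} {d : ℕ → ℝ} {r : ℝ} (hr : r < 1)
    (hx : ∀ n, ‖x (n + 1) - x n‖ = d n) (hd : StrictAnti d) (hdr : ∀ n, d n ≤ r ^ n) :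
    ∃ a : E, Filter.Tendsto x Filter.atTop (nhds a) ∧ ∀ n, ‖a - x n‖ = d n := by
  obtain ⟨a, ha⟩ := cauchySeq_tendsto_of_complete (cauchySeq_of_le_geometric r 1 hr
    (f := x) fun n => by
      rw [dist_comm, dist_eq_norm, hx, one_mul]
      exact hdr n)
  have hle (n k : ℕ) : ‖x (n + k) - x n‖ ≤ d n := by
    induction k with
    | zero => simp [← hx n]
    | succ k ih =>
      rw [← sub_add_sub_cancel _ (x (n + k))]
      refine (IsUltrametricDist.norm_add_le_max _ _).trans (max_le ?_ ih)
      rw [← add_assoc, hx]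
      exact hd.antitone (Nat.le_add_right n k)
  have hlim (n : ℕ) : ‖a - x n‖ ≤ d n := by
    refine le_of_tendsto (ha.sub_const (x n)).norm ?_
    filter_upwards [Filter.eventually_ge_atTop n] with k hk
    obtain ⟨j, rfl⟩ := Nat.exists_eq_add_of_le hk
    exact hle n j
  refine ⟨a, ha, fun n => ?_⟩
  have hlt : ‖a - x (n + 1)‖ < ‖x (n + 1) - x n‖ := by
    rw [hx]
    exact (hlim (n + 1)).trans_lt (hd n.lt_succ_self)
  rw [← sub_add_sub_cancel a (x (n + 1)) (x n),
    IsUltrametricDist.norm_add_eq_max_of_norm_ne_norm hlt.ne, max_eq_right hlt.le, hx]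

/-- In an ultrametric field, a continued fraction whose partial quotients after the first have norm
at least `R > 1` has denominators satisfying `R * ‖t n‖ ≤ ‖t (n + 1)‖`. -/
theorem continuant_norm_growth {K : Type*} [NormedField K] [IsUltrametricDist K] {R : ℝ}
    (hR : 1 < R) {c t : ℕ → K} (hc : ∀ j, 1 ≤ j → R ≤ ‖c j‖) (ht0 : t 0 = 1) (ht1 : t 1 = c 1)
    (ht : ∀ n, t (n + 2) = c (n + 2) * t (n + 1) + t n) (n : ℕ) :
    0 < ‖t n‖ ∧ R * ‖t n‖ ≤ ‖t (n + 1)‖ := by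
  induction n with
  | zero => simpa [ht0, ht1] using hc 1 le_rfl
  | succ n ih =>
    obtain ⟨hpos, hle⟩ := ih
    have hlt : ‖t n‖ < ‖t (n + 1)‖ := (lt_mul_of_one_lt_left hpos hR).trans_le hle
    have hpos' := hpos.trans hlt
    have hmul : R * ‖t (n + 1)‖ ≤ ‖c (n + 2) * t (n + 1)‖ := by
      rw [norm_mul]
      exact mul_le_mul_of_nonneg_right (hc _ (by omega)) hpos'.le
    have hlt' : ‖t n‖ < ‖c (n + 2) * t (n + 1)‖ :=
      (hlt.trans (lt_mul_of_one_lt_left hpos' hR)).trans_le hmul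
    refine ⟨hpos', ?_⟩
    rw [ht, IsUltrametricDist.norm_add_eq_max_of_norm_ne_norm hlt'.ne', max_eq_left hlt'.le]
    exact hmul

/-- The determinant identity for convergents of a continued fraction. -/
theorem convergents_determinant {K : Type*} [CommRing K] {c s t : ℕ → K}
    (hs0 : s 0 = c 0) (ht0 : t 0 = 1) (hs1 : s 1 = c 0 * c 1 + 1) (ht1 : t 1 = c 1)
    (hs : ∀ n, s (n + 2) = c (n + 2) * s (n + 1) + s n)
    (ht : ∀ n, t (n + 2) = c (n + 2) * t (n + 1) + t n) (n : ℕ) :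
    s (n + 1) * t n - s n * t (n + 1) = (-1) ^ n := by
  induction n with
  | zero => rw [hs0, ht0, zero_add, hs1, ht1]; ring
  | succ n ih => rw [hs, ht, pow_succ, ← ih]; ring

/-- if `c₀, c₁, c₂, … ∈ Z` with `c_j ∈ Z*` for `j ≥ 1`, then the sequence of
convergents `s_n / t_n = [c₀; c₁, …, c_n]` converges to an element `α ∈ K`, and
`|α - s_n / t_n| = 1 / (|t_n| |t_{n+1}|)` for every `n`. -/
theorem convergents_converge
    (p : ℕ) [Fact p.Prime] (K : Type*) [NontriviallyNormedField K]
    [Algebra ℚ_[p] K] [IsUltrametricDist K] [CompleteSpace K]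
    (e f m : ℕ) (he : 0 < e) (hf : 0 < f) (hm : m = e * f)
    (hnorm : ∀ x : ℚ_[p], ‖algebraMap ℚ_[p] K x‖ = ‖x‖)
    (hrank : Module.finrank ℚ_[p] K = m)
    (γ β : K)
    (hγnorm : ‖γ‖ = 1) (hγprim : IsPrimitiveRoot γ (p ^ f - 1))
    (hγdeg : (minpoly ℚ_[p] γ).natDegree = f)
    (hβ : ‖β‖ = (p : ℝ) ^ ((1 : ℝ) / (e : ℝ)))
    (X : Set ℚ_[p])
    (hX : X = RubanDigitSet p ∨ (Odd p ∧ X = BrowkinDigitSet p))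
    (c : ℕ → K)
    (hc0 : c 0 ∈ Zset p K e f γ β X)
    (hc : ∀ j : ℕ, 1 ≤ j → c j ∈ ZsetStar p K e f γ β X)
    (s t : ℕ → K)
    (hs0 : s 0 = c 0) (ht0 : t 0 = 1)
    (hs1 : s 1 = c 0 * c 1 + 1) (ht1 : t 1 = c 1)
    (hs : ∀ n : ℕ, s (n + 2) = c (n + 2) * s (n + 1) + s n)
    (ht : ∀ n : ℕ, t (n + 2) = c (n + 2) * t (n + 1) + t n) :
    ∃ α : K, Filter.Tendsto (fun n => s n / t n) Filter.atTop (nhds α) ∧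
      ∀ n : ℕ, ‖α - s n / t n‖ = 1 / (‖t n‖ * ‖t (n + 1)‖) := by
  let _ : NormedAlgebra ℚ_[p] K :=
    { ‹Algebra ℚ_[p] K› with
      norm_smul_le := fun a x => by rw [Algebra.smul_def, norm_mul, hnorm] }
  have : FiniteDimensional ℚ_[p] K :=
    Module.finite_of_finrank_pos (by rw [hrank, hm]; exact Nat.mul_pos he hf)
  have : ProperSpace K := FiniteDimensional.proper ℚ_[p] K
  obtain ⟨R, hR, hgap⟩ := exists_one_lt_forall_le_norm_of_one_lt_norm K
  have hgrowth := continuant_norm_growth hR (fun j hj => hgap _ (hc j hj).2) ht0 ht1 ht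
  have hpos (n : ℕ) : 0 < ‖t n‖ := (hgrowth n).1
  have hlt (n : ℕ) : ‖t n‖ < ‖t (n + 1)‖ :=
    (lt_mul_of_one_lt_left (hpos n) hR).trans_le (hgrowth n).2
  have hpow (n : ℕ) : R ^ n ≤ ‖t n‖ := by
    induction n with
    | zero => simp [ht0]
    | succ n ih =>
      rw [pow_succ']
      exact (mul_le_mul_of_nonneg_left ih (by linarith)).trans (hgrowth n).2
  refine exists_tendsto_norm_sub_eq_of_strictAnti (inv_lt_one_of_one_lt₀ hR) (fun n => ?_)
    (strictAnti_nat_of_succ_lt fun n => ?_) fun n => ?_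
  · have h₀ := norm_pos_iff.1 (hpos n)
    have h₁ := norm_pos_iff.1 (hpos (n + 1))
    rw [div_sub_div _ _ h₁ h₀, mul_comm (t (n + 1)) (s n),
      convergents_determinant hs0 ht0 hs1 ht1 hs ht n]
    simp [mul_comm]
  · exact one_div_lt_one_div_of_lt (mul_pos (hpos n) (hpos (n + 1)))
      (mul_lt_mul'' (hlt n) (hlt (n + 1)) (hpos n).le (hpos (n + 1)).le)
  · rw [inv_pow, ← one_div]
    have h₁ : 1 ≤ ‖t (n + 1)‖ := (one_le_pow₀ hR.le).trans (hpow (n + 1))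
    exact one_div_le_one_div_of_le (pow_pos (one_pos.trans hR) n)
      ((hpow n).trans (le_mul_of_one_le_right (hpos n).le h₁))
end

section
/- For any finite sequence c₁, …, c_n ∈ Z*, the cylinder set Δ_{c₁,…,c_n} equals the open ball B([0; c₁, …, c_n], |c₁ ⋯ c_n|^{−2}) centered at the finite continued fraction value [0; c₁, …, c_n] with radius |c₁ ⋯ c_n|^{−2}. -/
open scoped Classical

/-- The value of the finite continued fraction `[0; c₁, …, c_n]`, where the entries are
recorded as the list `[c₁, …, c_n]`:  `cfVal [] = 0` and
`cfVal (c :: rest) = 1 / (c + cfVal rest)`. -/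
def cfVal {K : Type*} [Field K] : List K → K
  | [] => 0
  | c :: rest => (c + cfVal rest)⁻¹

/-- In an ultrametric field, inversion exchanges small balls around `a` and around `a⁻¹`. -/
lemma mem_ball_inv_iff {K : Type*} [NormedField K] [IsUltrametricDist K] {a : K} {r : ℝ}
    (ha : a ≠ 0) (hr : r ≤ ‖a‖) (y : K) :
    y ∈ Metric.ball a⁻¹ (r * ‖a‖ ^ (-2 : ℤ)) ↔ y⁻¹ ∈ Metric.ball a r := by
  have norm_eq {x c : K} (h : ‖x - c‖ < ‖c‖) : ‖x‖ = ‖c‖ := by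
    have := IsUltrametricDist.norm_add_eq_max_of_norm_ne_norm h.ne
    rwa [sub_add_cancel, max_eq_right h.le] at this
  have ha' : 0 < ‖a‖ := norm_pos_iff.2 ha
  rw [mem_ball_iff_norm, mem_ball_iff_norm, zpow_neg, zpow_ofNat, ← div_eq_mul_inv]
  have key (h : ‖y‖ = ‖a‖⁻¹) : ‖y - a⁻¹‖ = ‖y⁻¹ - a‖ / ‖a‖ ^ 2 := by
    have hy : y ≠ 0 := by
      rintro rfl
      rw [norm_zero] at h
      exact (inv_pos.2 ha').ne h
    have : y - a⁻¹ = -(y⁻¹ - a) * y * a⁻¹ := by field_simp; ring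
    rw [this, norm_mul, norm_mul, norm_neg, norm_inv, h]
    field_simp
  constructor
  · intro h
    have hy : ‖y‖ = ‖a‖⁻¹ := by
      rw [← norm_inv]
      refine norm_eq (h.trans_le ?_)
      rw [norm_inv, div_le_iff₀ (by positivity)]
      field_simp
      exact hr
    rwa [key hy, div_lt_div_iff_of_pos_right (by positivity)] at h
  · intro h
    have hy : ‖y‖ = ‖a‖⁻¹ := by
      rw [← norm_eq (h.trans_le hr), norm_inv, inv_inv]
    rwa [key hy, div_lt_div_iff_of_pos_right (by positivity)]

lemma norm_add_eq_left_of_lt {K : Type*} [NormedField K] [IsUltrametricDist K] {c y : K}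
    (h : ‖y‖ < ‖c‖) : ‖c + y‖ = ‖c‖ := by
  rw [IsUltrametricDist.norm_add_eq_max_of_norm_ne_norm h.ne', max_eq_left h.le]

lemma norm_cfVal_lt_one {K : Type*} [NormedField K] [IsUltrametricDist K] (l : List K)
    (h : ∀ c ∈ l, 1 < ‖c‖) : ‖cfVal l‖ < 1 := by
  induction l with
  | nil => simp [cfVal]
  | cons c l ih =>
    rw [List.forall_mem_cons] at h
    rw [cfVal, norm_inv, norm_add_eq_left_of_lt ((ih h.2).trans h.1)]
    exact inv_lt_one_of_one_lt₀ h.1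

lemma prod_norm_zpow_neg_two_le_one {K : Type*} [NormedField K] (l : List K)
    (h : ∀ c ∈ l, 1 < ‖c‖) : (l.map (fun c => ‖c‖)).prod ^ (-2 : ℤ) ≤ 1 := by
  refine zpow_le_one_of_nonpos₀ (List.one_le_prod ?_) (by norm_num)
  simpa using fun c hc => (h c hc).le

lemma cylinder_eq_ball_of_one_lt_norm {K : Type*} [NormedField K] [IsUltrametricDist K]
    (cs : List K) (cn : K) (hcs : ∀ c ∈ cs, 1 < ‖c‖) (hcn : 1 < ‖cn‖) :
    {x : K | ∃ b : K, ‖b‖ < 1 ∧ x = cfVal (cs ++ [cn + b])} =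
      Metric.ball (cfVal (cs ++ [cn]))
        ((((cs ++ [cn]).map (fun c => ‖c‖)).prod) ^ (-2 : ℤ)) := by
  induction cs with
  | nil =>
    ext x
    have h := mem_ball_inv_iff (norm_pos_iff.1 (one_pos.trans hcn)) hcn.le x
    rw [one_mul] at h
    simp only [List.nil_append, cfVal, add_zero, List.map_cons, List.map_nil, List.prod_cons,
      List.prod_nil, mul_one, Set.mem_ofPred_eq]
    rw [h, mem_ball_iff_norm]
    constructor
    · rintro ⟨b, hb, rfl⟩
      simpa using hb
    · exact fun hx => ⟨x⁻¹ - cn, hx, by simp⟩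
  | cons c cs ih =>
    rw [List.forall_mem_cons] at hcs
    have hl : ∀ d ∈ cs ++ [cn], 1 < ‖d‖ := by
      simpa [or_imp, forall_and] using And.intro hcs.2 hcn
    have hnorm := norm_add_eq_left_of_lt ((norm_cfVal_lt_one _ hl).trans hcs.1)
    have hr := prod_norm_zpow_neg_two_le_one _ hl
    ext x
    have h := mem_ball_inv_iff (a := c + cfVal (cs ++ [cn]))
      (norm_pos_iff.1 (by rw [hnorm]; exact one_pos.trans hcs.1))
      (hr.trans (hnorm.symm ▸ hcs.1.le)) x
    rw [hnorm, ← mul_zpow, mul_comm] at h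
    simp only [List.cons_append, cfVal, List.map_cons, List.prod_cons, Set.mem_ofPred_eq]
    have hshift : x⁻¹ ∈ Metric.ball (c + cfVal (cs ++ [cn]))
        (((cs ++ [cn]).map (fun c => ‖c‖)).prod ^ (-2 : ℤ)) ↔
        x⁻¹ - c ∈ Metric.ball (cfVal (cs ++ [cn]))
        (((cs ++ [cn]).map (fun c => ‖c‖)).prod ^ (-2 : ℤ)) := by
      rw [mem_ball_iff_norm, mem_ball_iff_norm, sub_sub]
    rw [h, hshift, ← ih hcs.2]
    refine exists_congr fun b => and_congr_right fun _ => ?_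
    rw [sub_eq_iff_eq_add', inv_eq_iff_eq_inv]

/-- for any finite sequence `c₁, …, c_n ∈ Z*` (here written as
`cs ++ [cn]`), the cylinder set `Δ_{c₁,…,c_n} = {[0; c₁, …, c_{n-1}, c_n + β'] :
β' ∈ B(0,1)}` equals the open ball centered at `[0; c₁, …, c_n]` of radius
`|c₁ ⋯ c_n|⁻²`. -/
theorem cylinder_eq_ball
    (p : ℕ) [Fact p.Prime] (K : Type*) [NontriviallyNormedField K]
    [Algebra ℚ_[p] K] [IsUltrametricDist K]
    (e f m : ℕ) (he : 0 < e) (hf : 0 < f) (hm : m = e * f)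
    (hnorm : ∀ x : ℚ_[p], ‖algebraMap ℚ_[p] K x‖ = ‖x‖)
    (hrank : Module.finrank ℚ_[p] K = m)
    (γ β : K)
    (hγnorm : ‖γ‖ = 1) (hγprim : IsPrimitiveRoot γ (p ^ f - 1))
    (hγdeg : (minpoly ℚ_[p] γ).natDegree = f)
    (hβ : ‖β‖ = (p : ℝ) ^ ((1 : ℝ) / (e : ℝ)))
    (X : Set ℚ_[p])
    (hX : X = RubanDigitSet p ∨ (Odd p ∧ X = BrowkinDigitSet p))
    (cs : List K) (cn : K)
    (hcs : ∀ c ∈ cs, c ∈ ZsetStar p K e f γ β X)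
    (hcn : cn ∈ ZsetStar p K e f γ β X) :
    {x : K | ∃ b : K, ‖b‖ < 1 ∧ x = cfVal (cs ++ [cn + b])} =
      Metric.ball (cfVal (cs ++ [cn]))
        ((((cs ++ [cn]).map (fun c => ‖c‖)).prod) ^ (-2 : ℤ)) := by
  exact cylinder_eq_ball_of_one_lt_norm cs cn (fun c hc => (hcs c hc).2) hcn.2
end
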